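/- Let F be a finite lattice, and let Set_F^ω denote the category whose objects are pairs (X, v) with X a finite set and v : X → F a function, and whose morphisms (X, v) → (Y, w) are functions f : X → Y with w(f(x)) ≤ v(x) for all x. Then the Pro-completion (the free completion under cofiltered limits) of Set_F^ω is equivalent to Stone_F. -/

import Mathlib

open CategoryTheory

set_option autoImplicit false

/-- An object of the category `Stone_F`: a Stone space `X` (a `Profinite` space) together
with a map `v : X → F` such that each down-set preimage `{x | v x ≤ S}` is closed. -/
structure StoneF (F : Type) [Lattice F] : Type 1 where
  X : Profinite.{0}
  v : X → F
  closed : ∀ S : F, IsClosed {x : X | v x ≤ S}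

/-- The category `Stone_F`: morphisms `(X, v) → (Y, w)` are continuous maps `f : X → Y`
with `w (f x) ≤ v x` for all `x`. -/
instance StoneF.category (F : Type) [Lattice F] : Category (StoneF F) where
  Hom A B := {f : A.X → B.X // Continuous f ∧ ∀ x, B.v (f x) ≤ A.v x}
  id A := ⟨id, continuous_id, fun _ => le_rfl⟩
  comp f g := ⟨g.1 ∘ f.1, g.2.1.comp f.2.1, fun x => (g.2.2 _).trans (f.2.2 _)⟩
  id_comp _ := rfl
  comp_id _ := rfl
  assoc _ _ _ := rfl

/-- An object of `Set_F^ω`: a *finite* set `X` together with a map `v : X → F`. -/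
structure SetFinF (F : Type) [Lattice F] : Type 1 where
  X : Type
  [fin : Finite X]
  v : X → F

attribute [instance] SetFinF.fin

/-- The category `Set_F^ω`: morphisms `(X, v) → (Y, w)` are functions `f : X → Y` with
`w (f x) ≤ v x` for all `x`. -/
instance SetFinF.category (F : Type) [Lattice F] : Category (SetFinF F) where
  Hom A B := {f : A.X → B.X // ∀ x, B.v (f x) ≤ A.v x}
  id A := ⟨id, fun _ => le_rfl⟩
  comp f g := ⟨g.1 ∘ f.1, fun x => (g.2 _).trans (f.2 _)⟩
  id_comp _ := rfl
  comp_id _ := rfl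
  assoc _ _ _ := rfl

/-- The Pro-completion (free completion under cofiltered limits) of a category `C`,
realized as the opposite of the Ind-completion of `Cᵒᵖ`. -/
def ProCompletion (C : Type*) [Category C] := (Ind Cᵒᵖ)ᵒᵖ

noncomputable instance ProCompletion.category (C : Type*) [Category C] : Category (ProCompletion C) :=
  inferInstanceAs (Category (Ind Cᵒᵖ)ᵒᵖ)

open CategoryTheory Limits Opposite

theorem Set.exists_isLUB_of_finite {F : Type} [Finite F] [Lattice F] {s : Set F}
    (hs : s.Nonempty) : ∃ a, IsLUB s a := by
  have hf := s.toFinite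
  have hn : hf.toFinset.Nonempty := by simpa using hs
  exact ⟨hf.toFinset.sup' hn id, by simpa using hf.toFinset.isLUB_sup' hn ⟩

theorem Set.exists_isGLB_of_finite {F : Type} [Finite F] [Lattice F] {s : Set F}
    (hs : s.Nonempty) : ∃ a, IsGLB s a :=
  Set.exists_isLUB_of_finite (F := Fᵒᵈ) hs

namespace StoneF

variable {F : Type} [Lattice F]

/-- The morphisms from an object of `Stone_F` to a finite object, regarded as discrete. -/
def FinMap (X : StoneF F) (A : SetFinF F) : Type :=
  {f : X.X → A.X // IsLocallyConstant f ∧ ∀ x, A.v (f x) ≤ X.v x}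

/-- Composition of a map to a finite object with a morphism of `Set_F^ω`. -/
def FinMap.comp {X : StoneF F} {A B : SetFinF F} (h : A ⟶ B) (f : FinMap X A) : FinMap X B :=
  ⟨h.1 ∘ f.1, f.2.1.comp _, fun x => (h.2 _).trans (f.2.2 x)⟩

/-- The copresheaf on `Set_F^ω` corepresented by an object of `Stone_F`. -/
def presheaf (X : StoneF F) : (SetFinF F)ᵒᵖᵒᵖ ⥤ Type where
  obj A := FinMap X A.unop.unop
  map h := ↾FinMap.comp h.unop.unop

/-- The restricted contravariant Yoneda functor on `Stone_F`. -/
def presheafFunctor (F : Type) [Lattice F] : (StoneF F)ᵒᵖ ⥤ ((SetFinF F)ᵒᵖᵒᵖ ⥤ Type) where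
  obj X := X.unop.presheaf
  map φ :=
    { app := fun _ => ↾fun f => ⟨f.1 ∘ φ.unop.1, f.2.1.comp_continuous φ.unop.2.1,
        fun x => (f.2.2 _).trans (φ.unop.2.2 x)⟩ }

theorem presheaf_hom_comp {X Y : StoneF F} (η : Y.presheaf ⟶ X.presheaf) {A B : SetFinF F} (h : A ⟶ B)
    (f : FinMap Y A) :
    (show FinMap X B from η.app (op (op B)) (FinMap.comp h f)) =
      FinMap.comp h (η.app (op (op A)) f) :=
  NatTrans.naturality_apply η (X := op (op A)) (Y := op (op B)) h.op.op f

theorem isOpen_ge [Finite F] (X : StoneF F) (S : F) : IsOpen {x | S ≤ X.v x} := by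
  have : {x | S ≤ X.v x} = ⋂ T ∈ {T : F | ¬ S ≤ T}, {x | X.v x ≤ T}ᶜ := by
    ext x
    simp only [Set.mem_ofPred_eq, Set.mem_iInter, Set.mem_compl_iff]
    exact ⟨fun h T hT h' => hT (h.trans h'), fun h => by_contra fun h' => h _ h' le_rfl⟩
  rw [this]
  exact (Set.toFinite _).isOpen_biInter fun T _ => (X.closed T).isOpen_compl

section Quotient

variable [Finite F] (X : StoneF F)

theorem exists_isGLB_fiber (Q : DiscreteQuotient X.X) (q : Q) :
    ∃ a, IsGLB (X.v '' (Q.proj ⁻¹' {q})) a := by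
  obtain ⟨x, rfl⟩ := Q.proj_surjective q
  exact Set.exists_isGLB_of_finite ⟨_, x, rfl, rfl⟩

/-- A discrete quotient of a Stone space over `F`, with the largest compatible function to `F`. -/
noncomputable def quot (Q : DiscreteQuotient X.X) : SetFinF F where
  X := Q
  v q := (X.exists_isGLB_fiber Q q).choose

theorem isGLB_quot (Q : DiscreteQuotient X.X) (q : Q) :
    IsGLB (X.v '' (Q.proj ⁻¹' {q})) ((X.quot Q).v q) :=
  (X.exists_isGLB_fiber Q q).choose_spec

/-- The projection to a discrete quotient. -/
noncomputable def quotProj (Q : DiscreteQuotient X.X) : FinMap X (X.quot Q) :=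
  ⟨Q.proj, Q.proj_isLocallyConstant, fun x => (X.isGLB_quot Q _).1 ⟨x, rfl, rfl⟩⟩

/-- The transition map between discrete quotients. -/
noncomputable def quotMap {Q R : DiscreteQuotient X.X} (h : Q ≤ R) : X.quot Q ⟶ X.quot R :=
  ⟨DiscreteQuotient.ofLE h, fun q => by
    refine (X.isGLB_quot Q q).2 ?_
    rintro _ ⟨x, rfl, rfl⟩
    exact (X.isGLB_quot R _).1 ⟨x, (DiscreteQuotient.ofLE_proj h x).symm, rfl⟩⟩

theorem quotMap_comp_quotProj {Q R : DiscreteQuotient X.X} (h : Q ≤ R) :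
    FinMap.comp (X.quotMap h) (X.quotProj Q) = X.quotProj R :=
  Subtype.ext (DiscreteQuotient.ofLE_comp_proj h)

variable {X}

theorem FinMap.exists_factor {A : SetFinF F} (f : FinMap X A) :
    ∃ (Q : DiscreteQuotient X.X) (g : X.quot Q ⟶ A), FinMap.comp g (X.quotProj Q) = f := by
  let l : LocallyConstant X.X A.X := ⟨f.1, f.2.1⟩
  refine ⟨l.discreteQuotient, ⟨l.lift, fun q => ?_⟩, Subtype.ext l.lift_comp_proj⟩
  refine (X.isGLB_quot _ q).2 ?_
  rintro _ ⟨x, rfl, rfl⟩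
  exact f.2.2 x

end Quotient

section FullyFaithful

variable [Finite F] {X Y : StoneF F}

theorem exists_quot_le (X : StoneF F) (x : X.X) :
    ∃ Q : DiscreteQuotient X.X, X.v x ≤ (X.quot Q).v (Q.proj x) := by
  obtain ⟨U, hU, hxU, hUv⟩ := compact_exists_isClopen_in_isOpen (X.isOpen_ge (X.v x))
    (show x ∈ {y | X.v x ≤ X.v y} from le_rfl)
  refine ⟨DiscreteQuotient.ofIsClopen hU, (X.isGLB_quot _ _).2 ?_⟩
  rintro _ ⟨y, hy, rfl⟩
  exact hUv ((Quotient.exact hy : y ∈ U ↔ x ∈ U).2 hxU)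

instance : (presheafFunctor F).Faithful where
  map_injective {Y X} φ ψ h := by
    apply Quiver.Hom.unop_inj
    refine Subtype.ext (funext fun x => DiscreteQuotient.eq_of_forall_proj_eq fun Q => ?_)
    have := congrArg (fun η => η.app (op (op (Y.unop.quot Q)))) h
    have := ConcreteCategory.congr_hom this (Y.unop.quotProj Q)
    exact congrFun (congrArg Subtype.val this) x

/-- The value of a transformation of presheaves at the projection to a discrete quotient. -/
noncomputable def presheafHomQuot (η : Y.presheaf ⟶ X.presheaf) (Q : DiscreteQuotient Y.X) :
    FinMap X (Y.quot Q) :=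
  η.app (op (op (Y.quot Q))) (Y.quotProj Q)

theorem exists_lift (η : Y.presheaf ⟶ X.presheaf) (x : X.X) :
    ∃ y : Y.X, ∀ Q : DiscreteQuotient Y.X, Q.proj y = (presheafHomQuot η Q).1 x := by
  refine DiscreteQuotient.exists_of_compat _ fun A B h => ?_
  have := presheaf_hom_comp η (Y.quotMap h) (Y.quotProj A)
  rw [quotMap_comp_quotProj] at this
  exact (congrFun (congrArg Subtype.val this) x).symm

theorem exists_hom (η : Y.presheaf ⟶ X.presheaf) :
    ∃ f : X ⟶ Y, ∀ Q : DiscreteQuotient Y.X, Q.proj ∘ f.1 = (presheafHomQuot η Q).1 := by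
  choose f hf using exists_lift η
  refine ⟨⟨f, ?_, fun x => ?_⟩, fun Q => funext fun x => hf x Q⟩
  · rw [(isTopologicalBasis_isClopen (X := Y.X)).continuous_iff]
    intro U hU
    let Q := DiscreteQuotient.ofIsClopen hU
    have : f ⁻¹' U = (presheafHomQuot η Q).1 ⁻¹' (Q.proj '' U) := by
      ext x
      rw [Set.mem_preimage, Set.mem_preimage, ← hf x Q]
      refine ⟨fun h => ⟨_, h, rfl⟩, ?_⟩
      rintro ⟨y, hy, h⟩
      exact (Quotient.exact h : y ∈ U ↔ f x ∈ U).1 hy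
    rw [this]
    exact (presheafHomQuot η Q).2.1 _
  · obtain ⟨Q, hQ⟩ := Y.exists_quot_le (f x)
    refine hQ.trans ?_
    rw [hf x Q]
    exact (presheafHomQuot η Q).2.2 x

instance : (presheafFunctor F).Full where
  map_surjective {Y X} η := by
    obtain ⟨f, hf⟩ := exists_hom (Y := Y.unop) (X := X.unop) η
    refine ⟨f.op, ?_⟩
    ext A g
    obtain ⟨Q, h, rfl⟩ := FinMap.exists_factor (A := A.unop.unop) g
    refine Eq.trans ?_ (presheaf_hom_comp (Y := Y.unop) (X := X.unop) η h _).symm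
    exact Subtype.ext (congrArg (h.1 ∘ ·) (hf Q))

end FullyFaithful

section IndObject

variable {I : Type} [SmallCategory I] {D : I ⥤ (SetFinF F)ᵒᵖ} {X : StoneF F}

/-- A compatible family of maps from `X` to finite objects, as a cocone of presheaves. -/
def presheafCocone (π : ∀ i, FinMap X (D.obj i).unop)
    (hπ : ∀ {i j} (h : i ⟶ j), FinMap.comp (D.map h).unop (π j) = π i) :
    Cocone (D ⋙ yoneda) where
  pt := X.presheaf
  ι :=
    { app i := { app := fun _ => ↾fun g => FinMap.comp g.unop (π i) }
      naturality i j h := by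
        ext A g
        exact congrArg (FinMap.comp g.unop) (hπ h) }

theorem nonempty_isColimit_presheafCocone [IsFiltered I] (π : ∀ i, FinMap X (D.obj i).unop)
    (hπ : ∀ {i j} (h : i ⟶ j), FinMap.comp (D.map h).unop (π j) = π i)
    (hsurj : ∀ {A : SetFinF F} (f : FinMap X A), ∃ (i : I) (g : (D.obj i).unop ⟶ A),
      FinMap.comp g (π i) = f)
    (hinj : ∀ {A : SetFinF F} (i : I) (g g' : (D.obj i).unop ⟶ A),
      FinMap.comp g (π i) = FinMap.comp g' (π i) →
        ∃ (j : I) (h : i ⟶ j), (D.map h).unop ≫ g = (D.map h).unop ≫ g') :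
    Nonempty (IsColimit (presheafCocone π hπ)) := by
  refine ⟨evaluationJointlyReflectsColimits _ fun A =>
    Types.FilteredColimit.isColimitOf' _ _ (fun f => ?_) fun i g g' h => ?_⟩
  · obtain ⟨i, g, hg⟩ := hsurj (A := A.unop.unop) f
    exact ⟨i, g.op, hg.symm⟩
  · obtain ⟨j, k, hk⟩ := hinj (A := A.unop.unop) i (Quiver.Hom.unop g) (Quiver.Hom.unop g') h
    exact ⟨j, k, Quiver.Hom.unop_inj hk⟩

variable [Finite F]

/-- The diagram of discrete quotients of `X`. -/
noncomputable def quotDiagram (X : StoneF F) : (DiscreteQuotient X.X)ᵒᵖ ⥤ (SetFinF F)ᵒᵖ where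
  obj Q := op (X.quot Q.unop)
  map h := (X.quotMap h.unop.le).op
  map_id _ := Quiver.Hom.unop_inj (Subtype.ext DiscreteQuotient.ofLE_refl)
  map_comp h h' := Quiver.Hom.unop_inj
    (Subtype.ext (DiscreteQuotient.ofLE_comp_ofLE h'.unop.le h.unop.le).symm)

theorem isIndObject_presheaf (X : StoneF F) : IsIndObject X.presheaf := by
  obtain ⟨h⟩ := nonempty_isColimit_presheafCocone (D := X.quotDiagram)
    (fun Q => X.quotProj Q.unop) (fun h => X.quotMap_comp_quotProj h.unop.le)
    (fun f => ⟨op f.exists_factor.choose, f.exists_factor.choose_spec⟩)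
    fun Q g g' h => ⟨Q, 𝟙 Q, congrArg _ (Subtype.ext
      (Q.unop.proj_surjective.injective_comp_right (congrArg Subtype.val h)))⟩
  exact .mk (.ofCocone _ h)

end IndObject

section Limit

variable {J : Type} [SmallCategory J]

/-- The underlying finite set of an object of `Set_F^ω`, as a discrete profinite space. -/
def toProfinite (F : Type) [Lattice F] : SetFinF F ⥤ Profinite.{0} where
  obj A :=
    letI : TopologicalSpace A.X := ⊥
    haveI : DiscreteTopology A.X := ⟨rfl⟩
    Profinite.of A.X
  map {A B} f :=
    letI : TopologicalSpace A.X := ⊥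
    haveI : DiscreteTopology A.X := ⟨rfl⟩
    letI : TopologicalSpace B.X := ⊥
    haveI : DiscreteTopology B.X := ⟨rfl⟩
    CompHausLike.ofHom _ ⟨f.1, continuous_of_discreteTopology⟩

/-- The underlying Stone space of the limit of a diagram in `Set_F^ω`. -/
noncomputable abbrev limitCone (D : J ⥤ SetFinF F) : Cone (D ⋙ toProfinite F) :=
  Profinite.limitCone (D ⋙ toProfinite F)

/-- The projections of the limit. -/
def limitProj (D : J ⥤ SetFinF F) (j : J) (x : (limitCone D).pt) : (D.obj j).X :=
  x.1 j

theorem isLocallyConstant_limitProj (D : J ⥤ SetFinF F) (j : J) :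
    IsLocallyConstant (limitProj D j) := fun _ =>
  ((limitCone D).π.app j).hom.hom.continuous.isOpen_preimage _ trivial

theorem map_limitProj (D : J ⥤ SetFinF F) {i j : J} (h : i ⟶ j) (x : (limitCone D).pt) :
    (D.map h).1 (limitProj D i x) = limitProj D j x :=
  x.2 h

theorem exists_factor_limitProj [IsCofiltered J] (D : J ⥤ SetFinF F) {α : Type}
    {f : (limitCone D).pt → α} (hf : IsLocallyConstant f) :
    ∃ (j : J) (g : (D.obj j).X → α), f = g ∘ limitProj D j := by
  obtain ⟨j, g, hg⟩ := Profinite.exists_locallyConstant (limitCone D)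
    (Profinite.limitConeIsLimit _) ⟨f, hf⟩
  exact ⟨j, g, congrArg LocallyConstant.toFun hg⟩

/-- The underlying sets of a diagram in `Set_F^ω`. -/
def underlying (D : J ⥤ SetFinF F) : J ⥤ Type where
  obj j := (D.obj j).X
  map h := ↾(D.map h).1

instance (D : J ⥤ SetFinF F) (j : J) : Finite ((underlying D).obj j) :=
  (D.obj j).fin

theorem exists_range_subset_range_limitProj [IsCofiltered J] (D : J ⥤ SetFinF F) (i : J) :
    ∃ (j : J) (h : j ⟶ i), Set.range (D.map h).1 ⊆ Set.range (limitProj D i) := by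
  have hML : (underlying D).IsMittagLeffler :=
    (underlying D).isMittagLeffler_of_exists_finite_range fun j => ⟨j, 𝟙 j, Set.toFinite _⟩
  obtain ⟨j, h, hj⟩ := (underlying D).isMittagLeffler_iff_eventualRange.1 hML i
  refine ⟨j, h, fun a ha => ?_⟩
  have ha' : a ∈ (underlying D).eventualRange i := hj ▸ ha
  have : ∀ j, Nonempty ((underlying D).toEventualRanges.obj j) := fun j => by
    obtain ⟨k, f, g, -⟩ := IsCofilteredOrEmpty.cone_objs i j
    obtain ⟨b, hb, -⟩ := hML.subset_image_eventualRange _ f ha'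
    exact ⟨(underlying D).toEventualRanges.map g ⟨b, hb⟩⟩
  obtain ⟨s, hs⟩ := (underlying D).toEventualRanges.eval_section_surjective_of_surjective
    ((underlying D).surjective_toEventualRanges hML) i ⟨a, ha'⟩
  let t := (underlying D).toEventualRangesSectionsEquiv s
  exact ⟨⟨t.1, fun h => t.2 h⟩, congrArg Subtype.val hs⟩

theorem v_limitProj_mono (D : J ⥤ SetFinF F) {i j : J} (h : i ⟶ j) (x : (limitCone D).pt) :
    (D.obj j).v (limitProj D j x) ≤ (D.obj i).v (limitProj D i x) := by
  rw [← map_limitProj D h]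
  exact (D.map h).2 _

variable [IsCofiltered J] [Finite F]

theorem exists_isLUB_limitProj (D : J ⥤ SetFinF F) (x : (limitCone D).pt) :
    ∃ a, IsLUB (Set.range fun j => (D.obj j).v (limitProj D j x)) a :=
  have : Nonempty J := IsCofiltered.nonempty
  Set.exists_isLUB_of_finite (Set.range_nonempty _)

/-- The limit in `Stone_F` of a diagram in `Set_F^ω`. -/
noncomputable def limitObj (D : J ⥤ SetFinF F) : StoneF F where
  X := (limitCone D).pt
  v x := (exists_isLUB_limitProj D x).choose
  closed S := by
    have : {x | (exists_isLUB_limitProj D x).choose ≤ S} =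
        ⋂ j, limitProj D j ⁻¹' {a | (D.obj j).v a ≤ S} := by
      ext x
      simp [isLUB_le_iff (exists_isLUB_limitProj D x).choose_spec, upperBounds]
    rw [this]
    exact isClosed_iInter fun j => ⟨(isLocallyConstant_limitProj D j {a | (D.obj j).v a ≤ S}ᶜ)⟩

theorem isLUB_limitObj (D : J ⥤ SetFinF F) (x : (limitCone D).pt) :
    IsLUB (Set.range fun j => (D.obj j).v (limitProj D j x)) ((limitObj D).v x) :=
  (exists_isLUB_limitProj D x).choose_spec

/-- The limit projections as maps to finite objects. -/
noncomputable def limitFinMap (D : J ⥤ SetFinF F) (j : J) :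
    FinMap (limitObj D) (D.obj j) :=
  ⟨limitProj D j, isLocallyConstant_limitProj D j, fun x => (isLUB_limitObj D x).1 ⟨j, rfl⟩⟩

variable (D : J ⥤ SetFinF F)

theorem exists_v_le_v_limitProj (x : (limitCone D).pt) :
    ∃ j, (limitObj D).v x ≤ (D.obj j).v (limitProj D j x) := by
  have : Nonempty J := IsCofiltered.nonempty
  obtain ⟨_, ⟨j, rfl⟩, hj⟩ := (Set.toFinite
    (Set.range fun j => (D.obj j).v (limitProj D j x))).exists_maximal (Set.range_nonempty _)
  refine ⟨j, (isLUB_limitObj D x).2 ?_⟩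
  rintro _ ⟨i, rfl⟩
  obtain ⟨k, f, g, -⟩ := IsCofilteredOrEmpty.cone_objs i j
  exact (v_limitProj_mono D f x).trans (hj ⟨k, rfl⟩ (v_limitProj_mono D g x))

theorem exists_forall_v_le_v_limitProj {A : SetFinF F} (f : FinMap (limitObj D) A) (i : J) :
    ∃ (j : J) (_ : j ⟶ i), ∀ x, A.v (f.1 x) ≤ (D.obj j).v (limitProj D j x) := by
  classical
  choose j hj using exists_v_le_v_limitProj D
  let U (x : (limitCone D).pt) : Set (limitCone D).pt :=
    (fun y => (f.1 y, limitProj D (j x) y)) ⁻¹' {p | A.v p.1 ≤ (D.obj (j x)).v p.2}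
  have hU (x) : IsOpen (U x) := (f.2.1.prodMk (isLocallyConstant_limitProj D (j x))) _
  obtain ⟨t, ht⟩ := isCompact_univ.elim_finite_subcover U hU
    fun x _ => Set.mem_iUnion.2 ⟨x, (f.2.2 x).trans (hj x)⟩
  obtain ⟨k, hk⟩ := IsCofiltered.inf_objs_exists (insert i (t.image j))
  refine ⟨k, (hk (Finset.mem_insert_self _ _)).some, fun y => ?_⟩
  obtain ⟨x, hx, hy⟩ := Set.mem_iUnion₂.1 (ht (Set.mem_univ y))
  obtain ⟨h⟩ := hk (Finset.mem_insert_of_mem (Finset.mem_image_of_mem j hx))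
  exact le_trans hy (v_limitProj_mono D h y)

theorem exists_comp_limitFinMap_eq {A : SetFinF F} (f : FinMap (limitObj D) A) :
    ∃ (j : J) (g : D.obj j ⟶ A), FinMap.comp g (limitFinMap D j) = f := by
  obtain ⟨i, g, hg⟩ := exists_factor_limitProj D f.2.1
  obtain ⟨j, p, hp⟩ := exists_forall_v_le_v_limitProj D f i
  obtain ⟨k, q, hq⟩ := exists_range_subset_range_limitProj D j
  refine ⟨k, ⟨fun a => g ((D.map p).1 ((D.map q).1 a)), fun a => ?_⟩,
    Subtype.ext (funext fun x => ?_)⟩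
  · refine le_trans ?_ ((D.map q).2 a)
    obtain ⟨x, hx⟩ := hq ⟨a, rfl⟩
    change A.v (g ((D.map p).1 ((D.map q).1 a))) ≤ (D.obj j).v ((D.map q).1 a)
    rw [← hx, map_limitProj]
    exact (congrArg A.v (congrFun hg x)).symm.le.trans (hp x)
  · exact (congrArg g ((congrArg _ (map_limitProj D q x)).trans (map_limitProj D p x))).trans
      (congrFun hg x).symm

theorem exists_map_comp_eq {A : SetFinF F} (j : J) (g g' : D.obj j ⟶ A)
    (h : FinMap.comp g (limitFinMap D j) = FinMap.comp g' (limitFinMap D j)) :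
    ∃ (k : J) (f : k ⟶ j), D.map f ≫ g = D.map f ≫ g' := by
  obtain ⟨k, f, hf⟩ := exists_range_subset_range_limitProj D j
  refine ⟨k, f, Subtype.ext (funext fun a => ?_)⟩
  obtain ⟨x, hx⟩ := hf ⟨a, rfl⟩
  have := congrFun (congrArg Subtype.val h) x
  change g.1 ((D.map f).1 a) = g'.1 ((D.map f).1 a)
  rw [← hx]
  exact this

end Limit

/-- The restricted contravariant Yoneda functor, valued in ind-objects. -/
def indFunctor (F : Type) [Finite F] [Lattice F] :
    (StoneF F)ᵒᵖ ⥤ ObjectProperty.FullSubcategory (IsIndObject (C := (SetFinF F)ᵒᵖ)) :=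
  ObjectProperty.lift _ (presheafFunctor F) fun X => X.unop.isIndObject_presheaf

instance [Finite F] : (indFunctor F).Full :=
  Functor.Full.of_comp_faithful_iso (ObjectProperty.liftCompιIso _ (presheafFunctor F) _)

instance [Finite F] : (indFunctor F).Faithful :=
  Functor.Faithful.of_comp_iso (ObjectProperty.liftCompιIso _ (presheafFunctor F) _)

instance [Finite F] : (indFunctor F).EssSurj where
  mem_essImage := by
    rintro ⟨P, hP⟩
    let p := hP.presentation
    let D := p.F.leftOp
    obtain ⟨h⟩ := nonempty_isColimit_presheafCocone (D := p.F)
      (fun i => limitFinMap D (op i))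
      (fun f => Subtype.ext (funext fun x => map_limitProj D f.op x))
      (fun f => by
        obtain ⟨j, g, hg⟩ := exists_comp_limitFinMap_eq D f
        exact ⟨j.unop, g, hg⟩)
      fun i g g' hg => by
        obtain ⟨k, f, hf⟩ := exists_map_comp_eq D (op i) g g' hg
        exact ⟨k.unop, f.unop, hf⟩
    exact ⟨op (limitObj D),
      ⟨ObjectProperty.isoMk _ (h.coconePointUniqueUpToIso p.coconeIsColimit)⟩⟩

instance [Finite F] : (indFunctor F).IsEquivalence where

end StoneF

/-- For a finite lattice `F`, the Pro-completion of the category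
`Set_F^ω` of finite `F`-valued sets is equivalent to `Stone_F`. -/
theorem stoneF_is_pro_completion (F : Type) [Fintype F] [Lattice F] :
    Nonempty (ProCompletion (SetFinF F) ≌ StoneF F) := by
  let e : (StoneF F)ᵒᵖ ≌ Ind (SetFinF F)ᵒᵖ :=
    (StoneF.indFunctor F).asEquivalence.trans (Ind.equivalence _).symm
  exact ⟨(e.op.symm.trans (opOpEquivalence (StoneF F)) : (Ind (SetFinF F)ᵒᵖ)ᵒᵖ ≌ StoneF F)⟩
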